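/- Let K/k be a finite abelian extension of number fields with Galois group G. Let V be a finite set of finite places of k, and for each v ∈ V let D_v ≤ G be the decomposition group of v, i.e. the stabilizer in G of any place of K above v (well defined since G is abelian). Let S_K denote the set of places of K lying above places of V, and let U_{S} = O_{S_K}(K)ˣ denote the S-unit group of K (units of the ring of S_K-integers) and U_∞ = O_Kˣ the unit group of the ring of integers of K. Set e = ∏_{v∈V} (1 − e_{D_v}) ∈ ℚ[G]. Then, inside the ℚ[G]-module ℚ ⊗_ℤ U_S, the ℚ-subspace e·(ℚ ⊗_ℤ U_S) equals e·W, where W is the ℚ-subspace of ℚ ⊗_ℤ U_S spanned by the image of U_∞. -/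

import Mathlib

open NumberField IsDedekindDomain TensorProduct

/-- The natural action of a field automorphism `σ` of a number field `K` on the finite places of
`K`: the place `σ(v)`, whose prime ideal is `σ(v.asIdeal) = (σ⁻¹)⁻¹(v.asIdeal)`. -/
noncomputable def galSmul {k K : Type*} [Field k] [Field K] [NumberField K]
    [Algebra k K] (σ : K ≃ₐ[k] K) (v : HeightOneSpectrum (𝓞 K)) :
    HeightOneSpectrum (𝓞 K) where
  asIdeal := v.asIdeal.comap
    ((RingOfIntegers.mapRingEquiv (σ : K ≃+* K)).symm : 𝓞 K →+* 𝓞 K)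
  isPrime := by
    haveI := v.isPrime
    exact Ideal.IsPrime.comap _
  ne_bot := by
    intro h
    apply v.ne_bot
    have := Ideal.map_comap_of_surjective
      ((RingOfIntegers.mapRingEquiv (σ : K ≃+* K)).symm : 𝓞 K →+* 𝓞 K)
      (RingOfIntegers.mapRingEquiv (σ : K ≃+* K)).symm.surjective v.asIdeal
    rw [h, Ideal.map_bot] at this
    exact this.symm

/-- The `ℚ`-linear endomorphism of `ℚ ⊗ℤ Kˣ` induced by a field automorphism `σ` of `K`. -/
noncomputable def galTensorEnd {k K : Type*} [Field k] [Field K] [Algebra k K]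
    (σ : K ≃ₐ[k] K) : Module.End ℚ (ℚ ⊗[ℤ] Additive Kˣ) :=
  LinearMap.baseChange ℚ
    ((MonoidHom.toAdditive
      (Units.map σ.toRingEquiv.toRingHom.toMonoidHom)).toIntLinearMap)

/-! ### Products of commuting idempotents -/

theorem List.mul_prod_of_mem_of_isIdempotentElem {M : Type*} [Monoid M] {l : List M}
    (hc : ∀ a ∈ l, ∀ b ∈ l, Commute a b) (hi : ∀ a ∈ l, IsIdempotentElem a)
    {a : M} (ha : a ∈ l) : a * l.prod = l.prod := by
  induction l with
  | nil => simp at ha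
  | cons b t ih =>
    rw [List.prod_cons, ← mul_assoc]
    rcases List.mem_cons.mp ha with rfl | hat
    · rw [(hi a ha).eq]
    · rw [(hc a ha b List.mem_cons_self).eq, mul_assoc,
        ih (fun x hx y hy => hc x (List.mem_cons_of_mem _ hx) y (List.mem_cons_of_mem _ hy))
          (fun x hx => hi x (List.mem_cons_of_mem _ hx)) hat]

theorem List.prod_mul_eq_of_forall_mul_eq {M : Type*} [Monoid M] {l : List M} {p : M}
    (h : ∀ a ∈ l, a * p = p) : l.prod * p = p := by
  induction l with
  | nil => simp
  | cons b t ih =>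
    rw [List.prod_cons, mul_assoc, ih fun a ha => h a (List.mem_cons_of_mem _ ha),
      h b List.mem_cons_self]

theorem List.isIdempotentElem_prod {M : Type*} [Monoid M] {l : List M}
    (hc : ∀ a ∈ l, ∀ b ∈ l, Commute a b) (hi : ∀ a ∈ l, IsIdempotentElem a) :
    IsIdempotentElem l.prod :=
  List.prod_mul_eq_of_forall_mul_eq fun _ ha => List.mul_prod_of_mem_of_isIdempotentElem hc hi ha

/-! ### The Galois action on `ℚ ⊗ Kˣ` -/

section GaloisAction

variable {k K : Type*} [Field k] [Field K] [Algebra k K]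

theorem galTensorEnd_tmul (σ : K ≃ₐ[k] K) (q : ℚ) (x : Kˣ) :
    galTensorEnd σ (q ⊗ₜ[ℤ] Additive.ofMul x) =
      q ⊗ₜ[ℤ] Additive.ofMul (Units.map σ.toRingEquiv.toRingHom.toMonoidHom x) :=
  rfl

theorem galTensorEnd_mul (σ τ : K ≃ₐ[k] K) :
    galTensorEnd (σ * τ) = galTensorEnd σ * galTensorEnd τ := by
  ext x
  rfl

theorem commute_galTensorEnd {σ τ : K ≃ₐ[k] K} (h : σ * τ = τ * σ) :
    Commute (galTensorEnd σ) (galTensorEnd τ) := by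
  rw [commute_iff_eq, ← galTensorEnd_mul, h, galTensorEnd_mul]

/-- The idempotent `1 - e_D` acting on `ℚ ⊗ Kˣ`. -/
noncomputable def oneSubAverage (D : Subgroup (K ≃ₐ[k] K)) [Fintype D] :
    Module.End ℚ (ℚ ⊗[ℤ] Additive Kˣ) :=
  1 - (Fintype.card D : ℚ)⁻¹ • ∑ σ : D, galTensorEnd (k := k) (σ : K ≃ₐ[k] K)

theorem isIdempotentElem_oneSubAverage (D : Subgroup (K ≃ₐ[k] K)) [Fintype D] :
    IsIdempotentElem (oneSubAverage D) := by
  refine IsIdempotentElem.one_sub ?_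
  have hmul (σ : D) : galTensorEnd (σ : K ≃ₐ[k] K) * ∑ τ : D, galTensorEnd (τ : K ≃ₐ[k] K) =
      ∑ τ : D, galTensorEnd (τ : K ≃ₐ[k] K) := by
    rw [Finset.mul_sum]
    exact Fintype.sum_equiv (Equiv.mulLeft σ) _ _ fun τ => (galTensorEnd_mul _ _).symm
  have hcard : (Fintype.card D : ℚ) ≠ 0 := Nat.cast_ne_zero.mpr Fintype.card_ne_zero
  rw [IsIdempotentElem, smul_mul_smul_comm, Finset.sum_mul, Finset.sum_congr rfl fun σ _ => hmul σ,
    Finset.sum_const, Finset.card_univ, ← Nat.cast_smul_eq_nsmul ℚ, smul_smul, mul_assoc,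
    inv_mul_cancel₀ hcard, mul_one]

theorem commute_oneSubAverage (hab : ∀ σ τ : K ≃ₐ[k] K, σ * τ = τ * σ)
    (D E : Subgroup (K ≃ₐ[k] K)) [Fintype D] [Fintype E] :
    Commute (oneSubAverage D) (oneSubAverage E) := by
  have h : Commute (∑ σ : D, galTensorEnd (σ : K ≃ₐ[k] K))
      (∑ τ : E, galTensorEnd (τ : K ≃ₐ[k] K)) :=
    Commute.sum_left _ _ _ fun σ _ => Commute.sum_right _ _ _ fun τ _ =>
      commute_galTensorEnd (hab σ τ)
  have h_smul := (h.smul_left (Fintype.card D : ℚ)⁻¹).smul_right (Fintype.card E : ℚ)⁻¹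
  exact (Commute.one_left _).sub_left ((Commute.one_right _).sub_right h_smul)

theorem oneSubAverage_apply_mem {D : Subgroup (K ≃ₐ[k] K)} [Fintype D]
    {N : Submodule ℚ (ℚ ⊗[ℤ] Additive Kˣ)}
    (hN : ∀ σ : K ≃ₐ[k] K, ∀ y ∈ N, galTensorEnd σ y ∈ N)
    {y : ℚ ⊗[ℤ] Additive Kˣ} (hy : y ∈ N) : oneSubAverage D y ∈ N := by
  simp only [oneSubAverage, LinearMap.sub_apply, Module.End.one_apply, LinearMap.smul_apply,
    LinearMap.sum_apply]
  exact N.sub_mem hy (N.smul_mem _ (N.sum_mem fun σ _ => hN σ y hy))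

theorem apply_oneSubAverage_eq_zero {D : Subgroup (K ≃ₐ[k] K)} [Fintype D]
    {φ : ℚ ⊗[ℤ] Additive Kˣ →ₗ[ℚ] ℚ} (hφ : ∀ σ ∈ D, ∀ y, φ (galTensorEnd σ y) = φ y)
    (y : ℚ ⊗[ℤ] Additive Kˣ) : φ (oneSubAverage D y) = 0 := by
  have hcard : (Fintype.card D : ℚ) ≠ 0 := Nat.cast_ne_zero.mpr Fintype.card_ne_zero
  simp only [oneSubAverage, LinearMap.sub_apply, Module.End.one_apply, LinearMap.smul_apply,
    LinearMap.sum_apply, map_sub, map_smul, map_sum]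
  rw [Finset.sum_congr rfl fun (σ : D) _ => hφ σ σ.2 y, Finset.sum_const, Finset.card_univ,
    ← Nat.cast_smul_eq_nsmul ℚ, smul_smul, inv_mul_cancel₀ hcard, one_smul, sub_self]

end GaloisAction

/-! ### Valuations on `ℚ ⊗ Kˣ` -/

theorem TensorProduct.exists_natCast_smul_eq_one_tmul {A : Type*} [AddCommGroup A]
    (y : ℚ ⊗[ℤ] A) : ∃ N : ℕ, N ≠ 0 ∧ ∃ a : A, (N : ℚ) • y = 1 ⊗ₜ[ℤ] a := by
  induction y with
  | zero => exact ⟨1, one_ne_zero, 0, by simp⟩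
  | tmul q a =>
    refine ⟨q.den, q.den_ne_zero, q.num • a, ?_⟩
    rw [TensorProduct.smul_tmul', smul_eq_mul, Rat.den_mul_eq_num, TensorProduct.tmul_smul,
      TensorProduct.smul_tmul', zsmul_one]
  | add y z hy hz =>
    obtain ⟨N, hN, a, ha⟩ := hy
    obtain ⟨M, hM, b, hb⟩ := hz
    refine ⟨M * N, mul_ne_zero hM hN, (M : ℤ) • a + (N : ℤ) • b, ?_⟩
    rw [TensorProduct.tmul_add, TensorProduct.tmul_smul, TensorProduct.tmul_smul, ← ha, ← hb]
    simp only [natCast_zsmul, ← Nat.cast_smul_eq_nsmul ℚ, smul_smul, smul_add]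
    push_cast
    rw [mul_comm (N : ℚ) M]

section Valuations

variable {k K : Type*} [Field k] [Field K] [NumberField K] [Algebra k K]

theorem mem_galSmul_asIdeal_pow (σ : K ≃ₐ[k] K) (w : HeightOneSpectrum (𝓞 K)) (r : 𝓞 K) (n : ℕ) :
    RingOfIntegers.mapRingEquiv (σ : K ≃+* K) r ∈ (galSmul σ w).asIdeal ^ n ↔
      r ∈ w.asIdeal ^ n := by
  have h : (galSmul σ w).asIdeal =
      w.asIdeal.map (RingOfIntegers.mapRingEquiv (σ : K ≃+* K)) :=
    Ideal.comap_symm _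
  rw [h, ← Ideal.map_pow, ← Ideal.comap_symm, Ideal.mem_comap, RingEquiv.symm_apply_apply]

theorem intValuation_galSmul (σ : K ≃ₐ[k] K) (w : HeightOneSpectrum (𝓞 K)) (r : 𝓞 K) :
    (galSmul σ w).intValuation (RingOfIntegers.mapRingEquiv (σ : K ≃+* K) r) =
      w.intValuation r := by
  rcases eq_or_ne r 0 with rfl | hr
  · simp
  · rw [HeightOneSpectrum.intValuation_eq_exp_neg_multiplicity _
      ((map_ne_zero_iff _ (RingEquiv.injective _)).mpr hr),
      HeightOneSpectrum.intValuation_eq_exp_neg_multiplicity _ hr]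
    congr 3
    refine multiplicity_eq_of_emultiplicity_eq (emultiplicity_eq_emultiplicity_iff.mpr fun n => ?_)
    rw [Ideal.dvd_span_singleton, Ideal.dvd_span_singleton, mem_galSmul_asIdeal_pow]

theorem valuation_galSmul (σ : K ≃ₐ[k] K) (w : HeightOneSpectrum (𝓞 K)) (x : K) :
    (galSmul σ w).valuation K (σ x) = w.valuation K x := by
  have hval (r : 𝓞 K) : (galSmul σ w).valuation K (σ (algebraMap (𝓞 K) K r)) =
      w.valuation K (algebraMap (𝓞 K) K r) := by
    rw [HeightOneSpectrum.valuation_of_algebraMap, ← intValuation_galSmul σ,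
      ← HeightOneSpectrum.valuation_of_algebraMap (K := K)]
    rfl
  obtain ⟨a, b, -, rfl⟩ := IsFractionRing.div_surjective (A := 𝓞 K) x
  rw [map_div₀, map_div₀, map_div₀, hval, hval]

theorem galSmul_galSmul_inv (σ : K ≃ₐ[k] K) (w : HeightOneSpectrum (𝓞 K)) :
    galSmul σ (galSmul σ⁻¹ w) = w := by
  ext r
  change r ∈ ((w.asIdeal.comap _).comap _) ↔ _
  rw [Ideal.mem_comap, Ideal.mem_comap]
  suffices h : (RingOfIntegers.mapRingEquiv ((σ⁻¹ : K ≃ₐ[k] K) : K ≃+* K)).symm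
      ((RingOfIntegers.mapRingEquiv (σ : K ≃+* K)).symm r) = r from
    Iff.of_eq (congrArg (· ∈ w.asIdeal) h)
  ext
  exact σ.apply_symm_apply (r : K)

theorem comap_galSmul_asIdeal [NumberField k] (σ : K ≃ₐ[k] K) (w : HeightOneSpectrum (𝓞 K)) :
    (galSmul σ w).asIdeal.comap (algebraMap (𝓞 k) (𝓞 K)) =
      w.asIdeal.comap (algebraMap (𝓞 k) (𝓞 K)) := by
  ext r
  change r ∈ ((w.asIdeal.comap _).comap _) ↔ _
  rw [Ideal.mem_comap, Ideal.mem_comap, Ideal.mem_comap]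
  suffices h : (RingOfIntegers.mapRingEquiv (σ : K ≃+* K)).symm (algebraMap (𝓞 k) (𝓞 K) r) =
      algebraMap (𝓞 k) (𝓞 K) r from
    Iff.of_eq (congrArg (· ∈ w.asIdeal) h)
  ext
  exact σ.symm.commutes (r : k)

/-- The additive `w`-adic valuation, extended `ℚ`-linearly to `ℚ ⊗ Kˣ`. -/
noncomputable def tensorValuation (w : HeightOneSpectrum (𝓞 K)) :
    ℚ ⊗[ℤ] Additive Kˣ →ₗ[ℚ] ℚ :=
  (TensorProduct.AlgebraTensorModule.rid ℤ ℚ ℚ).toLinearMap ∘ₗ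
    LinearMap.baseChange ℚ
      (MonoidHom.toAdditiveLeft (w.valuationOfNeZero (K := K))).toIntLinearMap

theorem tensorValuation_tmul (w : HeightOneSpectrum (𝓞 K)) (q : ℚ) (x : Kˣ) :
    tensorValuation w (q ⊗ₜ[ℤ] Additive.ofMul x) =
      Multiplicative.toAdd (w.valuationOfNeZero x) • q :=
  rfl

theorem tensorValuation_one_tmul_eq_zero_iff {w : HeightOneSpectrum (𝓞 K)} {x : Kˣ} :
    tensorValuation w ((1 : ℚ) ⊗ₜ[ℤ] Additive.ofMul x) = 0 ↔ w.valuation K (x : K) = 1 := by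
  rw [tensorValuation_tmul, zsmul_one, Int.cast_eq_zero, toAdd_eq_zero,
    ← HeightOneSpectrum.valuationOfNeZero_eq, ← WithZero.coe_one, WithZero.coe_inj]

theorem tensorValuation_galSmul (σ : K ≃ₐ[k] K) (w : HeightOneSpectrum (𝓞 K))
    (y : ℚ ⊗[ℤ] Additive Kˣ) :
    tensorValuation (galSmul σ w) (galTensorEnd σ y) = tensorValuation w y := by
  induction y with
  | zero => simp
  | add y z hy hz => simp only [map_add, hy, hz]
  | tmul q a =>
    obtain ⟨x, rfl⟩ := Additive.ofMul.surjective a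
    rw [galTensorEnd_tmul, tensorValuation_tmul, tensorValuation_tmul]
    congr 2
    rw [← WithZero.coe_inj, HeightOneSpectrum.valuationOfNeZero_eq,
      HeightOneSpectrum.valuationOfNeZero_eq]
    exact valuation_galSmul σ w (x : K)

theorem mem_span_units_of_tensorValuation_eq_zero {y : ℚ ⊗[ℤ] Additive Kˣ}
    (hy : ∀ w : HeightOneSpectrum (𝓞 K), tensorValuation w y = 0) :
    y ∈ Submodule.span ℚ ((fun x : Kˣ => (1 : ℚ) ⊗ₜ[ℤ] Additive.ofMul x) ''
      (Set.range (fun t : (𝓞 K)ˣ => Units.map (algebraMap (𝓞 K) K).toMonoidHom t))) := by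
  obtain ⟨N, hN, a, ha⟩ := TensorProduct.exists_natCast_smul_eq_one_tmul y
  obtain ⟨x, rfl⟩ := Additive.ofMul.surjective a
  have hx (w : HeightOneSpectrum (𝓞 K)) : w.valuation K (x : K) = 1 := by
    rw [← tensorValuation_one_tmul_eq_zero_iff, ← ha, map_smul, hy, smul_zero]
  obtain ⟨r, hr⟩ := HeightOneSpectrum.mem_integers_of_valuation_le_one (R := 𝓞 K) K (x : K)
    fun w => (hx w).le
  obtain ⟨s, hs⟩ := HeightOneSpectrum.mem_integers_of_valuation_le_one (R := 𝓞 K) K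
    ((x⁻¹ : Kˣ) : K) fun w => by rw [Units.val_inv_eq_inv_val, map_inv₀, hx w, inv_one]
  have hrs : r * s = 1 := by
    apply FaithfulSMul.algebraMap_injective (𝓞 K) K
    rw [map_mul, hr, hs, Units.mul_inv, map_one]
  have hmem : (N : ℚ) • y ∈ Submodule.span ℚ
      ((fun x : Kˣ => (1 : ℚ) ⊗ₜ[ℤ] Additive.ofMul x) ''
        (Set.range (fun t : (𝓞 K)ˣ => Units.map (algebraMap (𝓞 K) K).toMonoidHom t))) := by
    rw [ha]
    exact Submodule.subset_span ⟨x, ⟨Units.mkOfMulEqOne r s hrs, Units.ext hr⟩, rfl⟩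
  exact (Submodule.smul_mem_iff _ (Nat.cast_ne_zero.mpr hN)).mp hmem

end Valuations

set_option synthInstance.maxHeartbeats 1000000 in
set_option maxHeartbeats 1000000 in
open scoped Classical in
/-- Let `K/k` be a finite abelian extension of number fields with Galois group
`G`, `V = {v 1, …, v n}` a finite set of finite places of `k` with decomposition groups
`D i ≤ G`, `S_K` the set of places of `K` above `V`, `U_S` the `S_K`-unit group of `K` and
`U_∞ = (𝓞 K)ˣ`.  With `e = ∏ (1 − e_{D i})` acting on `ℚ ⊗ℤ Kˣ`, the subspace
`e·(ℚ ⊗ U_S)` (the image under `e` of the span of the `S`-units) equals `e·W`, where `W` is the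
span of the image of `U_∞`. -/
theorem stmt6
    (k K : Type*) [Field k] [Field K] [NumberField k] [NumberField K]
    [Algebra k K] [IsGalois k K] [FiniteDimensional k K]
    (hab : ∀ σ τ : K ≃ₐ[k] K, σ * τ = τ * σ)
    (n : ℕ) (v : Fin n → HeightOneSpectrum (𝓞 k))
    (D : Fin n → Subgroup (K ≃ₐ[k] K))
    (hD : ∀ i : Fin n, ∀ w : HeightOneSpectrum (𝓞 K),
      w.asIdeal.comap (algebraMap (𝓞 k) (𝓞 K)) = (v i).asIdeal →
      ∀ σ : K ≃ₐ[k] K, σ ∈ D i ↔ galSmul σ w = w) :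
    let e : Module.End ℚ (ℚ ⊗[ℤ] Additive Kˣ) :=
      (List.ofFn (fun i : Fin n =>
        (1 : Module.End ℚ (ℚ ⊗[ℤ] Additive Kˣ)) -
          (Fintype.card (D i) : ℚ)⁻¹ •
            ∑ σ : (D i), galTensorEnd (k := k) (σ : K ≃ₐ[k] K))).prod
    Submodule.map e
      (Submodule.span ℚ
        ((fun x : Kˣ => (1 : ℚ) ⊗ₜ[ℤ] Additive.ofMul x) ''
          (({w : HeightOneSpectrum (𝓞 K) |
              ∃ i : Fin n, w.asIdeal.comap (algebraMap (𝓞 k) (𝓞 K)) = (v i).asIdeal}.unit K :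
            Subgroup Kˣ) : Set Kˣ))) =
    Submodule.map e
      (Submodule.span ℚ
        ((fun x : Kˣ => (1 : ℚ) ⊗ₜ[ℤ] Additive.ofMul x) ''
          (Set.range (fun t : (𝓞 K)ˣ =>
            Units.map (algebraMap (𝓞 K) K).toMonoidHom t)))) := by
  intro e
  let S : Set (HeightOneSpectrum (𝓞 K)) :=
    {w | ∃ i : Fin n, w.asIdeal.comap (algebraMap (𝓞 k) (𝓞 K)) = (v i).asIdeal}
  have he : e = (List.ofFn fun i => oneSubAverage (D i)).prod := rfl
  clear_value e
  have hc : ∀ a ∈ List.ofFn (fun i => oneSubAverage (D i)),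
      ∀ b ∈ List.ofFn (fun i => oneSubAverage (D i)), Commute a b := by
    simp only [List.forall_mem_ofFn_iff]
    exact fun i j => commute_oneSubAverage hab _ _
  have hi : ∀ a ∈ List.ofFn (fun i => oneSubAverage (D i)), IsIdempotentElem a := by
    simp only [List.forall_mem_ofFn_iff]
    exact fun i => isIdempotentElem_oneSubAverage _
  have hee : e * e = e := he ▸ List.isIdempotentElem_prod hc hi
  have hDe (i : Fin n) : oneSubAverage (D i) * e = e :=
    he ▸ List.mul_prod_of_mem_of_isIdempotentElem hc hi (List.mem_ofFn.mpr ⟨i, rfl⟩)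
  let N : Submodule ℚ (ℚ ⊗[ℤ] Additive Kˣ) :=
    ⨅ w : HeightOneSpectrum (𝓞 K), ⨅ _ : w ∉ S, LinearMap.ker (tensorValuation w)
  have hN {y} : y ∈ N ↔ ∀ w ∉ S, tensorValuation w y = 0 := by
    simp only [N, Submodule.mem_iInf, LinearMap.mem_ker]
  have hNσ (σ : K ≃ₐ[k] K) (y) (hy : y ∈ N) : galTensorEnd σ y ∈ N := by
    refine hN.mpr fun w hw => ?_
    rw [← galSmul_galSmul_inv σ w, tensorValuation_galSmul]
    refine hN.mp hy _ fun ⟨i, h⟩ => hw ⟨i, ?_⟩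
    rwa [comap_galSmul_asIdeal] at h
  have hNe : ∀ y ∈ N, e y ∈ N := by
    rw [he]
    refine List.prod_induction (fun f : Module.End ℚ (ℚ ⊗[ℤ] Additive Kˣ) => ∀ y ∈ N, f y ∈ N)
      (fun f g hf hg y hy => hf _ (hg _ hy)) (fun y hy => hy) ?_
    simp only [List.forall_mem_ofFn_iff]
    exact fun i y hy => oneSubAverage_apply_mem hNσ hy
  apply le_antisymm
  · rintro _ ⟨y, hy, rfl⟩
    have hyN : y ∈ N := by
      refine Submodule.span_le.mpr ?_ hy
      rintro _ ⟨x, hx, rfl⟩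
      exact hN.mpr fun w hw => tensorValuation_one_tmul_eq_zero_iff.mpr (hx w hw)
    refine ⟨e y, mem_span_units_of_tensorValuation_eq_zero fun w => ?_, LinearMap.congr_fun hee y⟩
    by_cases hw : w ∈ S
    · obtain ⟨i, h⟩ := hw
      rw [← hDe i, Module.End.mul_apply]
      refine apply_oneSubAverage_eq_zero (fun σ hσ z => ?_) _
      conv_lhs => rw [← (hD i w h σ).mp hσ]
      exact tensorValuation_galSmul σ w z
    · exact hN.mp (hNe y hyN) w hw
  · refine Submodule.map_mono (Submodule.span_mono (Set.image_mono ?_))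
    rintro _ ⟨t, rfl⟩ w -
    rw [← HeightOneSpectrum.valuationOfNeZero_eq, ← WithZero.coe_one, WithZero.coe_inj]
    exact w.valuation_of_unit_eq t
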